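/- There exist constants C > 0 and c > 0 with the following property. Let p = p(n) ∈ (0,1] and write d(n) := n·p(n). If p(n) = o(1) as n → ∞ and d(n) > C for all n, then, asymptotically almost surely, the random fooling-set pattern R(n,p(n)) contains a triangular principal submatrix with nonzero diagonal of size at least c·(ln d(n)/d(n))·n; that is, there is a subset I of the index set with |I| ≥ c·(ln d(n)/d(n))·n and an enumeration i_1, …, i_k of I such that R_{i_a, i_b} = 0 for all a < b. -/

import Mathlib

open Filter

/-- A fooling-set pattern: `1`s on the diagonal, and at least one of every pair of
diagonally opposite off-diagonal entries is `0`. -/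
def IsFoolingPattern {n : ℕ} (R : Matrix (Fin n) (Fin n) Bool) : Prop :=
  (∀ k, R k k = true) ∧ ∀ k ℓ, k ≠ ℓ → (R k ℓ = false ∨ R ℓ k = false)

/-- Number of off-diagonal `1`-entries of a pattern. -/
noncomputable def offDiagOnes {n : ℕ} (R : Matrix (Fin n) (Fin n) Bool) : ℕ :=
  Nat.card {q : Fin n × Fin n // q.1 ≠ q.2 ∧ R q.1 q.2 = true}

/-- `R` has density `p`: exactly `⌈p·C(n,2)⌉` off-diagonal `1`-entries. -/
def HasDensity {n : ℕ} (R : Matrix (Fin n) (Fin n) Bool) (p : ℝ) : Prop :=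
  offDiagOnes R = ⌈p * (n.choose 2 : ℝ)⌉₊

/-- Minimum rank over `𝔽` of a matrix with zero-nonzero pattern `R`. -/
noncomputable def minRank (𝔽 : Type*) [Field 𝔽] {n : ℕ}
    (R : Matrix (Fin n) (Fin n) Bool) : ℕ :=
  sInf {r | ∃ M : Matrix (Fin n) (Fin n) 𝔽,
    (∀ k ℓ, M k ℓ ≠ 0 ↔ R k ℓ = true) ∧ M.rank = r}


/-- The binomial distribution with parameters `N` and `m / N` has its mode at `m`. -/
theorem one_le_succ_mul_binomial_mode {N m : ℕ} (hm : m ≤ N) {q : ℝ} (hq0 : 0 ≤ q) (hq1 : q ≤ 1)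
    (hq : (m : ℝ) = N * q) :
    1 ≤ ((N : ℝ) + 1) * (N.choose m * q ^ m * (1 - q) ^ (N - m)) := by
  set t : ℕ → ℝ := fun i => N.choose i * q ^ i * (1 - q) ^ (N - i) with ht
  have h1q : 0 ≤ 1 - q := by linarith
  have key : ∀ i, i < N → ∃ A : ℝ, 0 ≤ A ∧ t i = A * ((i + 1) * (1 - q)) ∧
      t (i + 1) = A * ((N - i) * q) := by
    intro i hi
    refine ⟨N.choose i / (i + 1) * q ^ i * (1 - q) ^ (N - (i + 1)), by positivity, ?_, ?_⟩
    · have : N - i = (N - (i + 1)) + 1 := by omega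
      simp only [ht, this, pow_succ]
      field_simp
    · have h := Nat.choose_succ_right_eq N i
      have h' : (N.choose (i + 1) : ℝ) * (i + 1) = N.choose i * (N - i) := by
        rw [← Nat.cast_sub hi.le]; exact_mod_cast h
      have h'' : (N.choose (i + 1) : ℝ) = N.choose i * (N - i) / (i + 1) := by
        field_simp; linarith
      simp only [ht, h'', pow_succ]
      field_simp
  have up : ∀ i, i < m → t i ≤ t (i + 1) := by
    intro i hi
    obtain ⟨A, hA, h1, h2⟩ := key i (by omega)
    rw [h1, h2]
    refine mul_le_mul_of_nonneg_left ?_ hA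
    have : (i : ℝ) + 1 ≤ m := by exact_mod_cast hi
    nlinarith
  have down : ∀ i, m ≤ i → i < N → t (i + 1) ≤ t i := by
    intro i hi hiN
    obtain ⟨A, hA, h1, h2⟩ := key i hiN
    rw [h1, h2]
    refine mul_le_mul_of_nonneg_left ?_ hA
    have : (m : ℝ) ≤ i := by exact_mod_cast hi
    nlinarith
  have le_mode : ∀ i ∈ Finset.range (N + 1), t i ≤ t m := by
    intro i hi
    rcases le_total i m with h | h
    · have : ∀ j, j ≤ m → t i ≤ t (max i j) := by
        intro j
        induction j with
        | zero => simp
        | succ j ih =>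
          intro hj
          rcases le_or_gt i j with hij | hij
          · have e1 := ih (by omega)
            rw [max_eq_right hij] at e1
            rw [max_eq_right (by omega)]
            exact e1.trans (up j (by omega))
          · rw [max_eq_left (by omega)]
      simpa [h] using this m le_rfl
    · have : ∀ j, m ≤ j → j ≤ N → t j ≤ t m := by
        intro j hj
        induction j, hj using Nat.le_induction with
        | base => simp
        | succ j hj ih => exact fun h' => (down j hj (by omega)).trans (ih (by omega))
      exact this i h (by simpa [Nat.lt_succ_iff] using hi)
  have hsum : ∑ i ∈ Finset.range (N + 1), t i = 1 := by
    have := add_pow q (1 - q) N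
    rw [add_sub_cancel, one_pow] at this
    rw [this]
    exact Finset.sum_congr rfl fun i _ => by simp only [ht]; ring
  have := Finset.sum_le_card_nsmul _ _ _ le_mode
  rw [hsum] at this
  simpa using this

section Orientation

variable {E : Type*} [Fintype E]

/-- The number of coordinates on which a partial orientation is defined. -/
def supportCard (f : E → Option Bool) : ℕ := (Finset.univ.filter fun e => f e ≠ none).card

theorem card_supportCard_eq [DecidableEq E] (i : ℕ) :
    (Finset.univ.filter fun f : E → Option Bool => supportCard f = i).card
      = (Fintype.card E).choose i * 2 ^ i := by
  have h : ∑ f : E → Option Bool, (Polynomial.X : Polynomial ℕ) ^ supportCard f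
      = (1 + 2 * Polynomial.X) ^ Fintype.card E := by
    have h1 : ∀ f : E → Option Bool, (Polynomial.X : Polynomial ℕ) ^ supportCard f
        = ∏ e, (if f e ≠ none then Polynomial.X else 1) := by
      intro f
      rw [Finset.prod_ite]
      simp [supportCard]
    simp_rw [h1]
    have := Finset.prod_univ_sum (fun _ : E => (Finset.univ : Finset (Option Bool)))
      (fun _ x => if x ≠ none then (Polynomial.X : Polynomial ℕ) else 1)
    rw [Fintype.piFinset_univ] at this
    rw [← this]
    simp [Fintype.sum_option, two_mul]
  have h2 := congrArg (fun P => Polynomial.coeff P i) h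
  have h3 : ((1 : Polynomial ℕ) + 2 * Polynomial.X)
      = (1 + Polynomial.X : Polynomial ℕ).comp (2 * Polynomial.X) := by simp
  rw [h3, ← Polynomial.pow_comp] at h2
  have h4 : (2 * Polynomial.X : Polynomial ℕ) = Polynomial.C 2 * Polynomial.X := by simp
  simp only [h4, Polynomial.comp_C_mul_X_coeff, Polynomial.coeff_one_add_X_pow,
    Polynomial.finsetSum_coeff, Polynomial.coeff_X_pow] at h2
  rw [Finset.card_filter]
  simpa [eq_comm] using h2

/-- The weight of a coordinate value: undefined with probability `1 - q`, otherwise uniform. -/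
noncomputable def orientationWeight (q : ℝ) : Option Bool → ℝ
  | none => 1 - q
  | some _ => q / 2

theorem sum_weight_avoid [DecidableEq E] (q : ℝ) (U : Finset E) :
    ∑ f : E → Option Bool, (∏ e, orientationWeight q (f e)) *
      ∏ e ∈ U, (if f e = none then 1 else 0) = (1 - q) ^ U.card := by
  have h1 : ∀ f : E → Option Bool, (∏ e, orientationWeight q (f e)) *
      ∏ e ∈ U, (if f e = none then (1 : ℝ) else 0)
      = ∏ e, orientationWeight q (f e) *
          (if e ∈ U then (if f e = none then (1 : ℝ) else 0) else 1) := by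
    intro f
    rw [Finset.prod_mul_distrib, Finset.prod_ite_mem, Finset.univ_inter]
  simp_rw [h1]
  have := Finset.prod_univ_sum (fun _ : E => (Finset.univ : Finset (Option Bool)))
    (fun e x => orientationWeight q x *
          (if e ∈ U then (if x = none then (1 : ℝ) else 0) else 1))
  rw [Fintype.piFinset_univ] at this
  rw [← this]
  have h2 : ∀ e : E, ∑ x, orientationWeight q x *
          (if e ∈ U then (if x = none then (1 : ℝ) else 0) else 1)
      = if e ∈ U then 1 - q else 1 := by
    intro e
    split_ifs <;> simp [Fintype.sum_option, orientationWeight, mul_div_cancel₀]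
  simp_rw [h2]
  rw [Finset.prod_ite_mem, Finset.univ_inter, Finset.prod_const]

theorem sum_weight_hit [DecidableEq E] {V : Type*} [DecidableEq V] (q : ℝ) (s : Finset V) (B : V → Finset E)
    (hB : (s : Set V).PairwiseDisjoint B) :
    ∑ f : E → Option Bool, (∏ e, orientationWeight q (f e)) *
      ∏ v ∈ s, (1 - ∏ e ∈ B v, (if f e = none then 1 else 0))
      = ∏ v ∈ s, (1 - (1 - q) ^ (B v).card) := by
  simp_rw [sub_eq_neg_add, Finset.prod_add, Finset.mul_sum]
  rw [Finset.sum_comm]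
  refine Finset.sum_congr rfl fun t ht => ?_
  have ht' : (t : Set V).PairwiseDisjoint B :=
    hB.subset (by exact_mod_cast Finset.mem_powerset.1 ht)
  simp only [Finset.prod_const_one, mul_one, Finset.prod_neg]
  have : ∏ v ∈ t, (-q + 1) ^ (B v).card = (1 - q) ^ (t.biUnion B).card := by
    rw [Finset.card_biUnion ht', Finset.prod_pow_eq_pow_sum]; congr 1; ring
  rw [this, ← sum_weight_avoid, Finset.mul_sum]
  refine Finset.sum_congr rfl fun f _ => ?_
  rw [Finset.prod_biUnion ht']
  ring

theorem prod_orientationWeight (q : ℝ) (f : E → Option Bool) :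
    ∏ e, orientationWeight q (f e)
      = (q / 2) ^ supportCard f * (1 - q) ^ (Fintype.card E - supportCard f) := by
  have h : ∀ e, orientationWeight q (f e) = if f e ≠ none then q / 2 else 1 - q := by
    intro e
    cases f e <;> simp [orientationWeight]
  simp_rw [h]
  rw [Finset.prod_ite, Finset.prod_const, Finset.prod_const]
  congr 2
  have := Finset.card_filter_add_card_filter_not (s := (Finset.univ : Finset E))
    (fun e => f e ≠ none)
  rw [Finset.card_univ] at this
  simp only [supportCard]
  omega

open Classical in
/-- Among partial orientations with exactly `m` defined coordinates, the proportion of those that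
are defined somewhere on each of the disjoint blocks `B v` is at most `N + 1` times the
corresponding probability for independent coordinates. -/
theorem card_hit_le [DecidableEq E] {V : Type*} (s : Finset V) (B : V → Finset E)
    (hB : (s : Set V).PairwiseDisjoint B) {k m : ℕ} (hk : ∀ v ∈ s, (B v).card ≤ k)
    (hm : m ≤ Fintype.card E) {q : ℝ} (hq0 : 0 ≤ q) (hq1 : q ≤ 1)
    (hq : (m : ℝ) = Fintype.card E * q) :
    ((Finset.univ.filter fun f : E → Option Bool =>
        supportCard f = m ∧ ∀ v ∈ s, ∃ e ∈ B v, f e ≠ none).card : ℝ)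
      ≤ (Fintype.card E + 1) * (1 - (1 - q) ^ k) ^ s.card *
        (Finset.univ.filter fun f : E → Option Bool => supportCard f = m).card := by
  set N := Fintype.card E
  have h1q : 0 ≤ 1 - q := by linarith
  set w : ℝ := (q / 2) ^ m * (1 - q) ^ (N - m) with hw
  have hmode := one_le_succ_mul_binomial_mode hm hq0 hq1 hq
  have htot : ((Finset.univ.filter fun f : E → Option Bool => supportCard f = m).card : ℝ) * w
      = N.choose m * q ^ m * (1 - q) ^ (N - m) := by
    rw [card_supportCard_eq, hw, div_pow]
    push_cast
    change (N.choose m : ℝ) * 2 ^ m * _ = _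
    field_simp
  have hw0 : 0 < w := by
    have : 0 ≤ w := by positivity
    refine lt_of_le_of_ne this fun h0 => ?_
    rw [← htot, ← h0] at hmode
    norm_num at hmode
  have hX : ((Finset.univ.filter fun f : E → Option Bool =>
        supportCard f = m ∧ ∀ v ∈ s, ∃ e ∈ B v, f e ≠ none).card : ℝ) * w
      ≤ (1 - (1 - q) ^ k) ^ s.card := by
    calc _ = ∑ f ∈ Finset.univ.filter (fun f : E → Option Bool =>
              supportCard f = m ∧ ∀ v ∈ s, ∃ e ∈ B v, f e ≠ none),
              (∏ e, orientationWeight q (f e)) *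
                ∏ v ∈ s, (1 - ∏ e ∈ B v, (if f e = none then (1 : ℝ) else 0)) := by
          rw [← nsmul_eq_mul, ← Finset.sum_const]
          refine Finset.sum_congr rfl fun f hf => ?_
          obtain ⟨hf1, hf2⟩ := (Finset.mem_filter.1 hf).2
          rw [Finset.prod_eq_one (s := s), mul_one, prod_orientationWeight, hf1]
          intro v hv
          obtain ⟨e, he, hfe⟩ := hf2 v hv
          rw [Finset.prod_eq_zero he (by simp [hfe]), sub_zero]
      _ ≤ ∑ f : E → Option Bool, (∏ e, orientationWeight q (f e)) *
                ∏ v ∈ s, (1 - ∏ e ∈ B v, (if f e = none then (1 : ℝ) else 0)) := by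
          refine Finset.sum_le_sum_of_subset_of_nonneg (Finset.subset_univ _) fun f _ _ => ?_
          refine mul_nonneg (by rw [prod_orientationWeight]; positivity) ?_
          refine Finset.prod_nonneg fun v _ => sub_nonneg.2 ?_
          exact Finset.prod_le_one (fun e _ => by positivity) fun e _ => by split_ifs <;> simp
      _ = ∏ v ∈ s, (1 - (1 - q) ^ (B v).card) := sum_weight_hit q s B hB
      _ ≤ (1 - (1 - q) ^ k) ^ s.card := by
          rw [← Finset.prod_const]
          refine Finset.prod_le_prod (fun v _ => sub_nonneg.2 (pow_le_one₀ h1q (by linarith)))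
            fun v hv => ?_
          have := pow_le_pow_of_le_one h1q (by linarith) (hk v hv)
          linarith
  have hY : 0 ≤ (1 - (1 - q) ^ k) ^ s.card :=
    pow_nonneg (sub_nonneg.2 (pow_le_one₀ h1q (by linarith))) _
  refine le_of_mul_le_mul_right ?_ hw0
  refine hX.trans ?_
  calc (1 - (1 - q) ^ k) ^ s.card
      ≤ (1 - (1 - q) ^ k) ^ s.card *
          (((N : ℝ) + 1) * (N.choose m * q ^ m * (1 - q) ^ (N - m))) :=
        le_mul_of_one_le_right hY hmode
    _ = _ := by rw [← htot]; ring

end Orientation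

/-- The unordered pairs of distinct indices, represented as increasing ordered pairs. -/
abbrev IncPair (n : ℕ) : Type := {e : Fin n × Fin n // e.1 < e.2}

theorem card_incPair (n : ℕ) : Fintype.card (IncPair n) = n.choose 2 := by
  have h := Sym2.card_subtype_not_diag (α := Fin n)
  rw [Fintype.card_fin] at h
  rw [← h]
  refine Fintype.card_congr ?_
  refine Equiv.ofBijective (fun e => ⟨s(e.1.1, e.1.2), by simpa using e.2.ne⟩) ⟨?_, ?_⟩
  · rintro ⟨⟨a, b⟩, h1⟩ ⟨⟨c, d⟩, h2⟩ h
    simp only [Subtype.mk.injEq, Sym2.eq_iff, Prod.mk.injEq] at h ⊢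
    rcases h with h | ⟨rfl, rfl⟩
    · exact h
    · exact absurd h1 h2.asymm
  · rintro ⟨z, hz⟩
    induction z using Sym2.ind with
    | _ a b =>
      rcases lt_or_gt_of_ne (by simpa using hz : a ≠ b) with h | h
      · exact ⟨⟨(a, b), h⟩, rfl⟩
      · exact ⟨⟨(b, a), h⟩, Subtype.ext Sym2.eq_swap⟩

/-- The fooling-set pattern of a partial orientation of the complete graph. -/
def patternOf {n : ℕ} (f : IncPair n → Option Bool) : Matrix (Fin n) (Fin n) Bool := fun i j =>
  if h : i < j then f ⟨(i, j), h⟩ == some true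
  else if h : j < i then f ⟨(j, i), h⟩ == some false else true

section Pattern

variable {n : ℕ}

theorem patternOf_of_lt (f : IncPair n → Option Bool) {i j : Fin n} (h : i < j) :
    patternOf f i j = (f ⟨(i, j), h⟩ == some true) := by
  simp [patternOf, h]

theorem patternOf_of_gt (f : IncPair n → Option Bool) {i j : Fin n} (h : i < j) :
    patternOf f j i = (f ⟨(i, j), h⟩ == some false) := by
  simp [patternOf, h, h.asymm]

theorem isFoolingPattern_patternOf (f : IncPair n → Option Bool) :
    IsFoolingPattern (patternOf f) := by
  refine ⟨fun k => by simp [patternOf], fun k l hkl => ?_⟩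
  rcases lt_or_gt_of_ne hkl with h | h <;>
  · rw [patternOf_of_lt f h, patternOf_of_gt f h]
    rcases f _ with _ | _ | _ <;> simp

theorem patternOf_injective : Function.Injective (patternOf (n := n)) := by
  intro f g h
  funext ⟨⟨i, j⟩, hij⟩
  have h1 := congrFun (congrFun h i) j
  have h2 := congrFun (congrFun h j) i
  rw [patternOf_of_lt _ hij, patternOf_of_lt _ hij] at h1
  rw [patternOf_of_gt _ hij, patternOf_of_gt _ hij] at h2
  revert h1 h2
  rcases f _ with _ | _ | _ <;> rcases g _ with _ | _ | _ <;> simp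

theorem exists_patternOf_eq {R : Matrix (Fin n) (Fin n) Bool} (hR : IsFoolingPattern R) :
    ∃ f, patternOf f = R := by
  refine ⟨fun e => if R e.1.1 e.1.2 then some true else
    if R e.1.2 e.1.1 then some false else none, ?_⟩
  ext i j
  rcases lt_trichotomy i j with h | rfl | h
  · rw [patternOf_of_lt _ h]
    cases R i j <;> cases R j i <;> simp
  · simp [patternOf, hR.1]
  · rw [patternOf_of_gt _ h]
    have := hR.2 i j h.ne'
    cases h1 : R i j <;> cases h2 : R j i <;> simp_all

theorem card_isFoolingPattern_and (P : Matrix (Fin n) (Fin n) Bool → Prop) :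
    Nat.card {R : Matrix (Fin n) (Fin n) Bool // IsFoolingPattern R ∧ P R}
      = Nat.card {f : IncPair n → Option Bool // P (patternOf f)} := by
  symm
  refine Nat.card_congr (Equiv.ofBijective
    (fun f => ⟨patternOf f.1, isFoolingPattern_patternOf _, f.2⟩) ⟨?_, ?_⟩)
  · intro f g h
    exact Subtype.ext (patternOf_injective (congrArg Subtype.val h))
  · rintro ⟨R, hR, hP⟩
    obtain ⟨f, rfl⟩ := exists_patternOf_eq hR
    exact ⟨⟨f, hP⟩, rfl⟩

theorem offDiagOnes_patternOf (f : IncPair n → Option Bool) :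
    offDiagOnes (patternOf f) = supportCard f := by
  classical
  rw [supportCard, ← Fintype.card_subtype, ← Nat.card_eq_fintype_card, offDiagOnes]
  symm
  refine Nat.card_congr (Equiv.ofBijective
    (fun e => if h : f e.1 = some true then ⟨(e.1.1.1, e.1.1.2), e.1.2.ne, ?_⟩
      else ⟨(e.1.1.2, e.1.1.1), e.1.2.ne', ?_⟩) ⟨?_, ?_⟩)
  · rw [patternOf_of_lt _ e.1.2]
    simp [h]
  · rw [patternOf_of_gt _ e.1.2]
    have := e.2
    revert this h
    rcases f e.1 with _ | _ | _ <;> simp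
  · rintro ⟨⟨⟨a, b⟩, h1⟩, h2⟩ ⟨⟨⟨c, d⟩, h3⟩, h4⟩ h
    dsimp only at h
    dsimp only at h1 h3
    split_ifs at h <;> simp only [Subtype.mk.injEq, Prod.mk.injEq] at h ⊢ <;>
      obtain ⟨rfl, rfl⟩ := h <;> first | exact ⟨rfl, rfl⟩ | exact absurd h1 h3.asymm
  · rintro ⟨⟨i, j⟩, hij, hR⟩
    dsimp only at hij hR
    rcases lt_or_gt_of_ne hij with h | h
    · rw [patternOf_of_lt _ h] at hR
      have hR' : f ⟨(i, j), h⟩ = some true := by simpa using hR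
      exact ⟨⟨⟨(i, j), h⟩, by simp [hR']⟩, by simp [hR']⟩
    · rw [patternOf_of_gt _ h] at hR
      have hR' : f ⟨(j, i), h⟩ = some false := by simpa using hR
      exact ⟨⟨⟨(j, i), h⟩, by simp [hR']⟩, by simp [hR']⟩

/-- The pairs joining `v` to an element of `S`. -/
def pairsTo (S : Finset (Fin n)) (v : Fin n) : Finset (IncPair n) :=
  Finset.univ.filter fun e => (e.1.1 = v ∧ e.1.2 ∈ S) ∨ (e.1.2 = v ∧ e.1.1 ∈ S)

theorem card_pairsTo_le (S : Finset (Fin n)) {v : Fin n} (hv : v ∉ S) :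
    (pairsTo S v).card ≤ S.card := by
  refine Finset.card_le_card_of_injOn (fun e => if e.1.1 = v then e.1.2 else e.1.1) ?_ ?_
  · rintro ⟨⟨a, b⟩, h⟩ he
    simp only [pairsTo, Finset.coe_filter, Finset.mem_univ, true_and, Set.mem_ofPred_eq] at he
    rcases he with ⟨rfl, hb⟩ | ⟨rfl, ha⟩
    · simpa using hb
    · simpa [h.ne] using ha
  · rintro ⟨⟨a, b⟩, h⟩ he ⟨⟨c, d⟩, h'⟩ he' heq
    simp only [pairsTo, Finset.coe_filter, Finset.mem_univ, true_and, Set.mem_ofPred_eq] at he he'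
    dsimp only at h h'
    rcases he with ⟨rfl, hb⟩ | ⟨rfl, ha⟩ <;> rcases he' with ⟨rfl, hd⟩ | ⟨rfl, hc⟩
    · simpa using heq
    · simp only [↓reduceIte, h'.ne] at heq
      exact absurd h (heq ▸ h'.asymm)
    · simp only [↓reduceIte, h.ne] at heq
      exact absurd h (heq ▸ h'.asymm)
    · simpa [h.ne, h'.ne] using heq

theorem pairwiseDisjoint_pairsTo (S : Finset (Fin n)) :
    ((Sᶜ : Finset (Fin n)) : Set (Fin n)).PairwiseDisjoint (pairsTo S) := by
  intro v hv w hw hvw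
  rw [Function.onFun, Finset.disjoint_left]
  intro e he he'
  simp only [pairsTo, Finset.mem_filter, Finset.mem_univ, true_and] at he he'
  simp only [Finset.coe_compl, Set.mem_compl_iff, Finset.mem_coe] at hv hw
  rcases he with ⟨rfl, hb⟩ | ⟨rfl, ha⟩ <;> rcases he' with ⟨h1, hd⟩ | ⟨h1, hc⟩
  · exact hvw h1
  · exact hw (h1 ▸ hb)
  · exact hw (h1 ▸ ha)
  · exact hvw h1

/-- `R` has a triangular principal submatrix of size `k`. -/
def HasTriangular (R : Matrix (Fin n) (Fin n) Bool) (k : ℕ) : Prop :=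
  ∃ e : Fin k ↪ Fin n, ∀ a b : Fin k, a < b → R (e a) (e b) = false

theorem HasTriangular.mono {R : Matrix (Fin n) (Fin n) Bool} {k l : ℕ} (h : HasTriangular R l)
    (hkl : k ≤ l) : HasTriangular R k := by
  obtain ⟨e, he⟩ := h
  exact ⟨(Fin.castLEEmb hkl).trans e, fun a b hab => he _ _ (by simpa using hab)⟩

/-- Without a triangular principal submatrix of size `k`, some `k`-set is dominating: a maximal
independent set is dominating and has fewer than `k` elements. -/
theorem exists_dominating_of_not_hasTriangular {R : Matrix (Fin n) (Fin n) Bool} {k : ℕ}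
    (hkn : k ≤ n) (h : ¬ HasTriangular R k) :
    ∃ S : Finset (Fin n), S.card = k ∧ ∀ v ∉ S, ∃ s ∈ S, R v s = true ∨ R s v = true := by
  classical
  set I : Finset (Finset (Fin n)) := Finset.univ.filter fun S =>
    ∀ a ∈ S, ∀ b ∈ S, a ≠ b → R a b = false with hI
  obtain ⟨S, hS, hmax⟩ := I.exists_max_image Finset.card ⟨∅, by simp [hI]⟩
  have hSI : ∀ a ∈ S, ∀ b ∈ S, a ≠ b → R a b = false := by simpa [hI] using hS
  have hdom : ∀ v ∉ S, ∃ s ∈ S, R v s = true ∨ R s v = true := by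
    intro v hv
    by_contra! hcon
    have hmem : insert v S ∈ I := by
      simp only [hI, Finset.mem_filter, Finset.mem_univ, true_and, Finset.mem_insert]
      rintro a (rfl | ha) b (rfl | hb) hab
      · exact absurd rfl hab
      · simpa using (hcon b hb).1
      · simpa using (hcon a ha).2
      · exact hSI a ha b hb hab
    have := hmax _ hmem
    rw [Finset.card_insert_of_notMem hv] at this
    omega
  have hSk : S.card ≤ k := by
    by_contra! hlt
    refine h (HasTriangular.mono (l := S.card) ?_ hlt.le)
    refine ⟨(S.orderEmbOfFin rfl).toEmbedding, fun a b hab => ?_⟩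
    exact hSI _ (S.orderEmbOfFin_mem rfl a) _ (S.orderEmbOfFin_mem rfl b)
      (by simpa using hab.ne)
  obtain ⟨T, hST, hT⟩ := Finset.exists_superset_card_eq hSk (by simpa using hkn)
  refine ⟨T, hT, fun v hv => ?_⟩
  obtain ⟨s, hs, hvs⟩ := hdom v fun h' => hv (hST h')
  exact ⟨s, hST hs, hvs⟩

theorem exists_pairsTo_ne_none (f : IncPair n → Option Bool) {S : Finset (Fin n)} {v s : Fin n}
    (hv : v ∉ S) (hs : s ∈ S) (h : patternOf f v s = true ∨ patternOf f s v = true) :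
    ∃ e ∈ pairsTo S v, f e ≠ none := by
  have hne : v ≠ s := fun h => hv (h ▸ hs)
  rcases lt_or_gt_of_ne hne with hlt | hlt
  · refine ⟨⟨(v, s), hlt⟩, by simp [pairsTo, hs], fun h0 => ?_⟩
    simp [patternOf_of_lt f hlt, patternOf_of_gt f hlt, h0] at h
  · refine ⟨⟨(s, v), hlt⟩, by simp [pairsTo, hs], fun h0 => ?_⟩
    simp [patternOf_of_lt f hlt, patternOf_of_gt f hlt, h0] at h

/-- First-moment bound for the number of fooling-set patterns with `m` off-diagonal ones and no
triangular principal submatrix of size `k`. -/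
theorem card_not_hasTriangular_le {k m : ℕ} (hkn : k ≤ n) (hm : m ≤ n.choose 2) {q : ℝ}
    (hq0 : 0 ≤ q) (hq1 : q ≤ 1) (hq : (m : ℝ) = n.choose 2 * q) :
    (Nat.card {R : Matrix (Fin n) (Fin n) Bool //
        IsFoolingPattern R ∧ offDiagOnes R = m ∧ ¬ HasTriangular R k} : ℝ)
      ≤ n.choose k * ((n.choose 2 + 1) * (1 - (1 - q) ^ k) ^ (n - k)) *
        Nat.card {R : Matrix (Fin n) (Fin n) Bool // IsFoolingPattern R ∧ offDiagOnes R = m} := by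
  classical
  rw [card_isFoolingPattern_and, card_isFoolingPattern_and]
  simp only [offDiagOnes_patternOf, Nat.card_eq_fintype_card, Fintype.card_subtype]
  have hsub : (Finset.univ.filter fun f : IncPair n → Option Bool =>
        supportCard f = m ∧ ¬ HasTriangular (patternOf f) k)
      ⊆ (Finset.univ.powersetCard k).biUnion fun S => Finset.univ.filter fun f =>
        supportCard f = m ∧ ∀ v ∈ Sᶜ, ∃ e ∈ pairsTo S v, f e ≠ none := by
    intro f hf
    obtain ⟨hf1, hf2⟩ := (Finset.mem_filter.1 hf).2
    obtain ⟨S, hS, hdom⟩ := exists_dominating_of_not_hasTriangular hkn hf2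
    refine Finset.mem_biUnion.2 ⟨S, Finset.mem_powersetCard.2 ⟨Finset.subset_univ _, hS⟩,
      Finset.mem_filter.2 ⟨Finset.mem_univ _, hf1, fun v hv => ?_⟩⟩
    have hv' : v ∉ S := by simpa using hv
    obtain ⟨s, hs, h⟩ := hdom v hv'
    exact exists_pairsTo_ne_none f hv' hs h
  have hcard := (Finset.card_le_card hsub).trans Finset.card_biUnion_le
  refine (Nat.cast_le.2 hcard).trans ?_
  push_cast
  refine (Finset.sum_le_card_nsmul _ _ ((n.choose 2 + 1) * (1 - (1 - q) ^ k) ^ (n - k) *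
    ((Finset.univ.filter fun f : IncPair n → Option Bool => supportCard f = m).card : ℝ))
    fun S hS => ?_).trans ?_
  · have hSk := (Finset.mem_powersetCard.1 hS).2
    have := card_hit_le (Sᶜ) (pairsTo S) (pairwiseDisjoint_pairsTo S) (k := k) (m := m) (q := q)
      (fun v hv => (card_pairsTo_le S (by simpa using hv)).trans_eq hSk)
      (by rwa [card_incPair]) hq0 hq1 (by rwa [card_incPair])
    rw [card_incPair, Finset.card_compl, Fintype.card_fin, hSk] at this
    refine Eq.trans_le ?_ (this.trans_eq ?_) <;> congr!
  · rw [Finset.card_powersetCard, Finset.card_univ, Fintype.card_fin, nsmul_eq_mul, ← mul_assoc]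

end Pattern

theorem card_offDiagOnes_pos {n m : ℕ} (hm : m ≤ n.choose 2) :
    0 < Nat.card {R : Matrix (Fin n) (Fin n) Bool // IsFoolingPattern R ∧ offDiagOnes R = m} := by
  classical
  rw [card_isFoolingPattern_and]
  simp only [offDiagOnes_patternOf, Nat.card_eq_fintype_card, Fintype.card_subtype]
  rw [card_supportCard_eq, card_incPair]
  exact Nat.mul_pos (Nat.choose_pos hm) (by positivity)

section Estimates

theorem exp_neg_two_mul_le_one_sub {q : ℝ} (hq0 : 0 ≤ q) (hq : q ≤ 1 / 2) :
    Real.exp (-(2 * q)) ≤ 1 - q := by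
  have h1 : 0 < 1 - q := by linarith
  rw [← Real.le_log_iff_exp_le h1]
  refine le_trans ?_ (Real.one_sub_inv_le_log_of_pos h1)
  have : (1 - q)⁻¹ ≤ 1 + 2 * q := by
    rw [inv_le_iff_one_le_mul₀ h1]
    nlinarith
  linarith

theorem log_mul_log_add_seven_le {d : ℝ} (hd : 1 < d) :
    Real.log d * (Real.log d + 7) ≤ 30 * √d := by
  have hd0 : 0 ≤ d := by linarith
  set r := √(√d) with hr
  have hr1 : 1 ≤ r := by
    rw [hr, Real.one_le_sqrt, Real.one_le_sqrt]; exact hd.le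
  have hs : √d = r ^ 2 := (Real.sq_sqrt (Real.sqrt_nonneg d)).symm
  have hd4 : d = r ^ 4 := by
    have := Real.sq_sqrt hd0
    rw [hs] at this
    rw [← this]; ring
  have hlog : Real.log d = 4 * Real.log r := by
    rw [hd4, Real.log_pow]; norm_num
  have h1 := Real.log_le_sub_one_of_pos (show 0 < r by linarith)
  have h0 := Real.log_nonneg hr1
  rw [hlog, hs]
  have h2 : Real.log r * Real.log r ≤ (r - 1) * (r - 1) := by gcongr
  nlinarith [sq_nonneg (r - 1)]

theorem log_le_self_of_one_lt {d : ℝ} (hd : 1 < d) : Real.log d ≤ d := by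
  linarith [Real.log_le_sub_one_of_pos (show 0 < d by linarith)]

theorem choose_le_exp_mul_pow (n k : ℕ) {x : ℝ} (hx : 0 < x) :
    (n.choose k : ℝ) ≤ Real.exp (x * n) * x⁻¹ ^ k := by
  rw [inv_pow, ← div_eq_mul_inv, le_div_iff₀ (by positivity)]
  calc (n.choose k : ℝ) * x ^ k ≤ (x + 1) ^ n := by
        rw [add_pow]
        rcases le_or_gt k n with h | h
        · refine le_trans (le_of_eq ?_) (Finset.single_le_sum
            (f := fun i => x ^ i * 1 ^ (n - i) * (n.choose i : ℝ))
            (fun i _ => by positivity) (Finset.mem_range.2 (Nat.lt_succ_of_le h)))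
          simp [mul_comm]
        · rw [Nat.choose_eq_zero_of_lt h]
          simp only [Nat.cast_zero, zero_mul]
          exact Finset.sum_nonneg fun i _ => by positivity
    _ ≤ Real.exp x ^ n := by gcongr; exact Real.add_one_le_exp x
    _ = Real.exp (x * n) := by rw [← Real.exp_nat_mul, mul_comm]

theorem log_1024_le : Real.log 1024 ≤ 7 := by
  have : (1024 : ℝ) = 2 ^ 10 := by norm_num
  rw [this, Real.log_pow]
  have := Real.log_two_lt_d9
  norm_num
  linarith

theorem choose_le_of_le {n k : ℕ} {d : ℝ} (hd : 1 < d)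
    (hk : (k : ℝ) ≤ 1 / 1024 * (Real.log d / d) * n + 1) :
    (n.choose k : ℝ) ≤ 1024 * d * Real.exp (n / (32 * √d)) := by
  have hd0 : 0 < d := by linarith
  have hs0 : 0 < √d := Real.sqrt_pos.2 hd0
  have hs1 : 1 ≤ √d := Real.one_le_sqrt.2 hd.le
  have hss : √d * √d = d := Real.mul_self_sqrt hd0.le
  have hx : 0 < 1 / (1024 * d) := by positivity
  refine (choose_le_exp_mul_pow n k hx).trans ?_
  have hpow : (1 / (1024 * d))⁻¹ ^ k = Real.exp (k * (Real.log 1024 + Real.log d)) := by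
    rw [← Real.log_mul (by norm_num) hd0.ne', Real.exp_nat_mul, Real.exp_log (by positivity)]
    simp
  have hpre : 1024 * d = Real.exp (Real.log 1024 + Real.log d) := by
    rw [← Real.log_mul (by norm_num) hd0.ne', Real.exp_log (by positivity)]
  rw [hpow, hpre, ← Real.exp_add, ← Real.exp_add, Real.exp_le_exp, ← hpre]
  have hL : 0 ≤ Real.log d := Real.log_nonneg hd.le
  have hA : 0 ≤ Real.log 1024 := Real.log_nonneg (by norm_num)
  have h1 : (k : ℝ) * (Real.log 1024 + Real.log d)
      ≤ (1 / 1024 * (Real.log d / d) * n + 1) * (Real.log 1024 + Real.log d) := by gcongr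
  have h2 : 1 / 1024 * (Real.log d / d) * n * (Real.log 1024 + Real.log d)
      ≤ 30 / 1024 * (n / √d) := by
    calc _ ≤ 1 / 1024 * (Real.log d / d) * n * (7 + Real.log d) := by
          gcongr; exact log_1024_le
      _ = 1 / 1024 * (n / d) * (Real.log d * (Real.log d + 7)) := by ring
      _ ≤ 1 / 1024 * (n / d) * (30 * √d) := by
          exact mul_le_mul_of_nonneg_left (log_mul_log_add_seven_le hd) (by positivity)
      _ = 30 / 1024 * (n / √d) := by
          nth_rewrite 1 [← hss]; field_simp
  have h3 : 1 / (1024 * d) * n ≤ 1 / 1024 * (n / √d) := by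
    rw [show 1 / (1024 * d) * (n : ℝ) = 1 / 1024 * (n / d) by field_simp]
    gcongr
    nlinarith
  have h4 : (n : ℝ) / (32 * √d) = 32 / 1024 * (n / √d) := by field_simp; norm_num
  have h5 : 0 ≤ (n : ℝ) / √d := by positivity
  rw [h4]
  linarith

/-- The bound of `card_not_hasTriangular_le` is superpolynomially small when `k` is a small
multiple of `(log d / d) * n`. -/
theorem first_moment_le {n k : ℕ} {p q : ℝ} (hn : 4 ≤ n) (hd : 1 < n * p) (hp : p ≤ 1 / 8)
    (hq0 : 0 ≤ q) (hqp : q ≤ 2 * p)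
    (hk : (k : ℝ) ≤ 1 / 1024 * (Real.log (n * p) / (n * p)) * n + 1) :
    (n.choose k : ℝ) * ((n.choose 2 + 1) * (1 - (1 - q) ^ k) ^ (n - k))
      ≤ 1024 * n ^ 3 * Real.exp (-(√n / 8)) := by
  have hn' : (4 : ℝ) ≤ n := by exact_mod_cast hn
  have hn0 : (0 : ℝ) < n := by linarith
  have hp0 : 0 < p := pos_of_mul_pos_right (by linarith : 0 < (n : ℝ) * p) hn0.le
  set d := (n : ℝ) * p with hdef
  have hd0 : 0 < d := by linarith
  have hdn : d ≤ n := by nlinarith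
  have hs0 : 0 < √d := Real.sqrt_pos.2 hd0
  have hL : 0 ≤ Real.log d := Real.log_nonneg hd.le
  have hkn2 : (k : ℝ) ≤ n / 2 := by
    have : Real.log d / d ≤ 1 := (div_le_one hd0).2 (log_le_self_of_one_lt hd)
    nlinarith
  have hkn : k ≤ n := by
    have : (k : ℝ) ≤ n := by linarith
    exact_mod_cast this
  have hpk : p * k ≤ 1 / 1024 * Real.log d + p := by
    calc p * k ≤ p * (1 / 1024 * (Real.log d / d) * n + 1) := by gcongr
      _ = 1 / 1024 * Real.log d * ((n * p) / d) + p := by ring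
      _ = _ := by rw [← hdef, div_self hd0.ne', mul_one]
  have hpow : 1 / (2 * √d) ≤ (1 - q) ^ k := by
    calc 1 / (2 * √d) = 1 / 2 * Real.exp (-(Real.log d / 2)) := by
          rw [Real.exp_neg, Real.exp_half, Real.exp_log hd0]; field_simp
      _ ≤ Real.exp (-(1 / 2)) * Real.exp (-(Real.log d / 2)) := by
          gcongr; linarith [Real.add_one_le_exp (-(1 / 2) : ℝ)]
      _ ≤ Real.exp (k * (-(2 * q))) := by
          rw [← Real.exp_add, Real.exp_le_exp]
          have : q * k ≤ 2 * p * k := by gcongr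
          nlinarith
      _ = Real.exp (-(2 * q)) ^ k := Real.exp_nat_mul _ _
      _ ≤ (1 - q) ^ k := by
          gcongr; exact exp_neg_two_mul_le_one_sub hq0 (by linarith)
  have hmiss : (1 - (1 - q) ^ k) ^ (n - k) ≤ Real.exp (-(n / (4 * √d))) := by
    have h0 : 0 ≤ 1 - (1 - q) ^ k :=
      sub_nonneg.2 (pow_le_one₀ (by linarith) (by linarith))
    calc (1 - (1 - q) ^ k) ^ (n - k) ≤ Real.exp (-(1 / (2 * √d))) ^ (n - k) := by
          gcongr
          linarith [Real.add_one_le_exp (-(1 / (2 * √d)))]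
      _ = Real.exp ((n - k : ℕ) * -(1 / (2 * √d))) := (Real.exp_nat_mul _ _).symm
      _ ≤ _ := by
          rw [Real.exp_le_exp, Nat.cast_sub hkn, mul_neg, neg_le_neg_iff]
          calc (n : ℝ) / (4 * √d) = (n / 2) * (1 / (2 * √d)) := by field_simp; norm_num
            _ ≤ (n - k) * (1 / (2 * √d)) := by gcongr; linarith
  have hN : (n.choose 2 : ℝ) + 1 ≤ n ^ 2 := by
    rw [Nat.cast_choose_two]
    nlinarith
  have hexp : Real.exp (n / (32 * √d)) * Real.exp (-(n / (4 * √d))) ≤ Real.exp (-(√n / 8)) := by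
    rw [← Real.exp_add, Real.exp_le_exp]
    have h1 : √n ≤ n / √d := by
      rw [le_div_iff₀ hs0]
      calc √n * √d ≤ √n * √n := by gcongr
        _ = n := Real.mul_self_sqrt hn0.le
    have h2 : (n : ℝ) / (32 * √d) = 1 / 32 * (n / √d) := by field_simp
    have h3 : (n : ℝ) / (4 * √d) = 1 / 4 * (n / √d) := by field_simp
    have h4 : 0 ≤ √(n : ℝ) := Real.sqrt_nonneg _
    rw [h2, h3]
    linarith
  have h0 : 0 ≤ (1 - (1 - q) ^ k) ^ (n - k) :=
    pow_nonneg (sub_nonneg.2 (pow_le_one₀ (by linarith) (by linarith))) _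
  calc (n.choose k : ℝ) * ((n.choose 2 + 1) * (1 - (1 - q) ^ k) ^ (n - k))
      ≤ (1024 * d * Real.exp (n / (32 * √d))) * (n ^ 2 * Real.exp (-(n / (4 * √d)))) := by
        gcongr
        exact choose_le_of_le hd hk
    _ = 1024 * d * n ^ 2 * (Real.exp (n / (32 * √d)) * Real.exp (-(n / (4 * √d)))) := by ring
    _ ≤ 1024 * n * n ^ 2 * Real.exp (-(√n / 8)) := by gcongr
    _ = _ := by ring

theorem tendsto_first_moment_bound :
    Tendsto (fun n : ℕ => 1024 * (n : ℝ) ^ 3 * Real.exp (-(√n / 8))) atTop (nhds 0) := by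
  have h1 : Tendsto (fun n : ℕ => √(n : ℝ) / 8) atTop atTop :=
    (Real.tendsto_sqrt_atTop.comp tendsto_natCast_atTop_atTop).atTop_div_const (by norm_num)
  have h2 := ((Real.tendsto_pow_mul_exp_neg_atTop_nhds_zero 6).comp h1).const_mul
    (1024 * 8 ^ 6 : ℝ)
  rw [mul_zero] at h2
  refine h2.congr fun n => ?_
  have h3 : (√(n : ℝ)) ^ 2 = n := Real.sq_sqrt (Nat.cast_nonneg n)
  simp only [Function.comp_apply]
  rw [← h3, Real.sqrt_sq (Real.sqrt_nonneg _)]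
  ring

end Estimates

section Density

variable {n : ℕ}

theorem ceil_density_le_choose {p : ℝ} (hp1 : p ≤ 1) :
    ⌈p * (n.choose 2 : ℝ)⌉₊ ≤ n.choose 2 :=
  Nat.ceil_le.2 (mul_le_of_le_one_left (Nat.cast_nonneg _) hp1)

/-- The proportion of patterns of density `p` with no triangular principal submatrix of size
`(1 / 1024) * (log d / d) * n`, where `d = n * p`. -/
theorem card_not_hasTriangular_le_of_density {p : ℝ} (hn : 4 ≤ n) (hp0 : 0 < p) (hp : p ≤ 1 / 8) :
    (Nat.card {R : Matrix (Fin n) (Fin n) Bool // IsFoolingPattern R ∧ HasDensity R p ∧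
        ¬ HasTriangular R ⌈1 / 1024 * (Real.log (n * p) / (n * p)) * n⌉₊} : ℝ)
      ≤ 1024 * n ^ 3 * Real.exp (-(√n / 8)) *
        Nat.card {R : Matrix (Fin n) (Fin n) Bool // IsFoolingPattern R ∧ HasDensity R p} := by
  have hn' : (4 : ℝ) ≤ n := by exact_mod_cast hn
  rcases le_or_gt ((n : ℝ) * p) 1 with hd | hd
  · have h0 : 1 / 1024 * (Real.log (n * p) / (n * p)) * n ≤ 0 := by
      have hd0 : 0 < (n : ℝ) * p := by positivity
      have h1 : Real.log (n * p) / (n * p) ≤ 0 :=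
        div_nonpos_of_nonpos_of_nonneg (Real.log_nonpos hd0.le hd) hd0.le
      nlinarith
    rw [Nat.ceil_eq_zero.2 h0]
    have hempty : IsEmpty {R : Matrix (Fin n) (Fin n) Bool // IsFoolingPattern R ∧
        HasDensity R p ∧ ¬ HasTriangular R 0} :=
      ⟨fun R => R.2.2.2 ⟨⟨Fin.elim0, fun a => a.elim0⟩, fun a => a.elim0⟩⟩
    rw [Nat.card_of_isEmpty, Nat.cast_zero]
    positivity
  · set k := ⌈1 / 1024 * (Real.log (n * p) / (n * p)) * n⌉₊ with hkdef
    set m := ⌈p * (n.choose 2 : ℝ)⌉₊ with hmdef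
    have hL : 0 ≤ Real.log (n * p) / (n * p) :=
      div_nonneg (Real.log_nonneg hd.le) (by linarith)
    have hk : (k : ℝ) ≤ 1 / 1024 * (Real.log (n * p) / (n * p)) * n + 1 :=
      (Nat.ceil_lt_add_one (by positivity)).le
    have hkn : k ≤ n := by
      have h1 : Real.log (n * p) / (n * p) ≤ 1 :=
        (div_le_one (by linarith)).2 (log_le_self_of_one_lt hd)
      have : (k : ℝ) ≤ n := by nlinarith
      exact_mod_cast this
    have hN : (n.choose 2 : ℝ) = n * (n - 1) / 2 := Nat.cast_choose_two ℝ n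
    have hN0 : 0 < (n.choose 2 : ℝ) := by rw [hN]; nlinarith
    have hpN : 1 ≤ p * (n.choose 2 : ℝ) := by rw [hN]; nlinarith
    have hmN : m ≤ n.choose 2 := ceil_density_le_choose (by linarith)
    set q : ℝ := m / n.choose 2 with hq
    have hmq : (m : ℝ) = n.choose 2 * q := by rw [hq]; field_simp
    have hq0 : 0 ≤ q := by positivity
    have hqp : q ≤ 2 * p := by
      rw [hq, div_le_iff₀ hN0]
      have : (m : ℝ) < p * n.choose 2 + 1 := Nat.ceil_lt_add_one (by positivity)
      linarith
    refine (card_not_hasTriangular_le hkn hmN hq0 (by linarith) hmq).trans ?_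
    exact mul_le_mul_of_nonneg_right (first_moment_le hn hd hp hq0 hqp hk) (Nat.cast_nonneg _)

theorem hasTriangular_ceil_iff {R : Matrix (Fin n) (Fin n) Bool} {x : ℝ} :
    HasTriangular R ⌈x⌉₊ ↔ ∃ (k : ℕ) (e : Fin k ↪ Fin n),
      x ≤ (k : ℝ) ∧ ∀ a b : Fin k, a < b → R (e a) (e b) = false := by
  constructor
  · rintro ⟨e, he⟩
    exact ⟨_, e, Nat.le_ceil x, he⟩
  · rintro ⟨k, e, hk, he⟩
    exact HasTriangular.mono ⟨e, he⟩ (Nat.ceil_le.2 hk)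

end Density

theorem card_and_add_card_and_not {α : Type*} [Finite α] (P Q T : α → Prop) :
    Nat.card {x // P x ∧ Q x ∧ T x} + Nat.card {x // P x ∧ Q x ∧ ¬ T x}
      = Nat.card {x // P x ∧ Q x} := by
  classical
  have := Fintype.ofFinite α
  simp only [Nat.card_eq_fintype_card, Fintype.card_subtype]
  rw [← Finset.card_filter_add_card_filter_not (s := Finset.univ.filter fun x => P x ∧ Q x) T,
    Finset.filter_filter, Finset.filter_filter]
  simp only [and_assoc]

/-- Almost all fooling-set patterns of density `p n → 0` have a triangular principal submatrix of
size at least `(1 / 1024) * (log d / d) * n`, where `d = n * p n`; no lower bound on `d` is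
needed. -/
theorem tendsto_card_hasTriangular_div (p : ℕ → ℝ) (hp0 : ∀ n, 0 < p n)
    (hp : Tendsto p atTop (nhds 0)) :
    Tendsto (fun n : ℕ =>
        (Nat.card {R : Matrix (Fin n) (Fin n) Bool // IsFoolingPattern R ∧ HasDensity R (p n) ∧
          HasTriangular R ⌈1 / 1024 * (Real.log (n * p n) / (n * p n)) * n⌉₊} : ℝ) /
        (Nat.card {R : Matrix (Fin n) (Fin n) Bool //
          IsFoolingPattern R ∧ HasDensity R (p n)} : ℝ))
      atTop (nhds 1) := by
  have hlow : Tendsto (fun n : ℕ => 1 - 1024 * (n : ℝ) ^ 3 * Real.exp (-(√n / 8)))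
      atTop (nhds 1) := by
    simpa using tendsto_first_moment_bound.const_sub 1
  have hev : ∀ᶠ n in atTop, p n ≤ 1 / 8 :=
    (hp.eventually (gt_mem_nhds (by norm_num : (0 : ℝ) < 1 / 8))).mono fun _ h => le_of_lt h
  refine tendsto_of_tendsto_of_tendsto_of_le_of_le' hlow tendsto_const_nhds ?_ ?_
  all_goals
    filter_upwards [hev, eventually_ge_atTop 4] with n hpn hn
    have htot : (0 : ℝ) < Nat.card {R : Matrix (Fin n) (Fin n) Bool //
        IsFoolingPattern R ∧ HasDensity R (p n)} :=
      Nat.cast_pos.2 (card_offDiagOnes_pos (ceil_density_le_choose (by linarith)))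
    have hsplit := congrArg (Nat.cast (R := ℝ)) (card_and_add_card_and_not
      (fun R : Matrix (Fin n) (Fin n) Bool => IsFoolingPattern R) (fun R => HasDensity R (p n))
      (fun R => HasTriangular R ⌈1 / 1024 * (Real.log (n * p n) / (n * p n)) * n⌉₊))
    rw [Nat.cast_add] at hsplit
  · have hbad := card_not_hasTriangular_le_of_density hn (hp0 n) hpn
    rw [le_div_iff₀ htot]
    linarith
  · rw [div_le_one htot]
    linarith [Nat.cast_nonneg (α := ℝ) (Nat.card {R : Matrix (Fin n) (Fin n) Bool //
      IsFoolingPattern R ∧ HasDensity R (p n) ∧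
        ¬ HasTriangular R ⌈1 / 1024 * (Real.log (n * p n) / (n * p n)) * n⌉₊})]

/-- Lemma 3: for `p(n) = d(n)/n = o(1)` with `d(n)` bounded below by a constant `C`,
a.a.s. `R(n,p)` contains a triangular principal submatrix with nonzero diagonal of size
`Ω((ln d / d)·n)`. -/
theorem aas_triangular_submatrix :
    ∃ C c : ℝ, 0 < C ∧ 0 < c ∧
      ∀ p : ℕ → ℝ, (∀ n, 0 < p n) → (∀ n, p n ≤ 1) →
        Tendsto p atTop (nhds 0) →
        (∀ n : ℕ, 0 < n → C < n * p n) →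
        Tendsto (fun n : ℕ =>
            (Nat.card {R : Matrix (Fin n) (Fin n) Bool //
                IsFoolingPattern R ∧ HasDensity R (p n) ∧
                ∃ (k : ℕ) (e : Fin k ↪ Fin n),
                  c * (Real.log (n * p n) / (n * p n)) * n ≤ (k : ℝ) ∧
                  ∀ a b : Fin k, a < b → R (e a) (e b) = false} : ℝ) /
            (Nat.card {R : Matrix (Fin n) (Fin n) Bool //
                IsFoolingPattern R ∧ HasDensity R (p n)} : ℝ))
          atTop (nhds 1) := by
  refine ⟨1 / 2, 1 / 1024, by norm_num, by norm_num, fun p hp0 _ hp _ => ?_⟩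
  simp_rw [← hasTriangular_ceil_iff]
  exact tendsto_card_hasTriangular_div p hp0 hp
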